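/- Fix an integer p ≥ 2 and an integer K ≥ 1. For each k = 1,…,K let t_k be a knot sequence in (0,1) and let S(p, t_k) be the corresponding spline space; for g_k ∈ S(p, t_k) let P(g_k) be the ℓ¹ norm of the coefficient vector of g_k in the truncated power basis of S(p, t_k). Let F_n be the set of sums g = Σ_{k=1}^K g_k with g_k ∈ S(p, t_k), with penalty P(g) = Σ_{k=1}^K P(g_k), and set F_n(1) = {g ∈ F_n : P(g) ≤ 1}. Then there exists a constant M > 0, independent of δ, of n, of the design points, and of the knot sequences, such that for all δ > 0, log N₂(δ, ‖·‖_n, F_n(1)) ≤ M·δ^{−1/p}. -/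

import Mathlib

open Finset

/-- Evaluation of a spline written in the truncated power basis of `S(p, t)` with `m` knots
`t 1, …, t m` and coefficient vector `b`:
`x ↦ Σ_{j<p} b j · x^j + Σ_{i<m} b (p+i) · (x − t (i+1))₊^{p−1}`. -/
noncomputable def splineEval (p m : ℕ) (t : ℕ → ℝ) (b : ℕ → ℝ) (x : ℝ) : ℝ :=
  (∑ j ∈ Finset.range p, b j * x ^ j) +
    ∑ i ∈ Finset.range m, b (p + i) * max (x - t (i + 1)) 0 ^ (p - 1)

/-- A family of functions `F θ`, `θ ∈ P`, has a uniform `ε`-net on `D` of log-cardinality at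
most `H`. -/
def HasUniformNet {Θ X : Type*} (P : Set Θ) (D : Set X) (F : Θ → X → ℝ) (ε H : ℝ) : Prop :=
  ∃ T : Finset (X → ℝ), (T.card : ℝ) ≤ Real.exp H ∧
    ∀ θ ∈ P, ∃ g ∈ T, ∀ x ∈ D, |F θ x - g x| ≤ ε

namespace HasUniformNet

variable {Θ X : Type*} {P : Set Θ} {D : Set X}

theorem mono {F : Θ → X → ℝ} {ε ε' H H' : ℝ} (h : HasUniformNet P D F ε H) (hε : ε ≤ ε')
    (hH : H ≤ H') : HasUniformNet P D F ε' H' := by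
  obtain ⟨T, hT, hc⟩ := h
  refine ⟨T, hT.trans (Real.exp_le_exp.2 hH), fun θ hθ => ?_⟩
  obtain ⟨g, hg, h⟩ := hc θ hθ
  exact ⟨g, hg, fun x hx => (h x hx).trans hε⟩

theorem congr {F G : Θ → X → ℝ} {ε H : ℝ} (h : HasUniformNet P D F ε H)
    (hFG : ∀ θ ∈ P, ∀ x ∈ D, G θ x = F θ x) : HasUniformNet P D G ε H := by
  obtain ⟨T, hT, hc⟩ := h
  refine ⟨T, hT, fun θ hθ => ?_⟩
  obtain ⟨g, hg, h⟩ := hc θ hθ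
  exact ⟨g, hg, fun x hx => by rw [hFG θ hθ x hx]; exact h x hx⟩

theorem comp {F : Θ → X → ℝ} {ε H : ℝ} (h : HasUniformNet P D F ε H)
    {Θ' X' : Type*} {P' : Set Θ'} {D' : Set X'} {u : Θ' → Θ} {v : X' → X}
    (hu : Set.MapsTo u P' P) (hv : Set.MapsTo v D' D) :
    HasUniformNet P' D' (fun θ x => F (u θ) (v x)) ε H := by
  classical
  obtain ⟨T, hT, hc⟩ := h
  refine ⟨T.image (fun g x => g (v x)), le_trans (by exact_mod_cast Finset.card_image_le) hT,
    fun θ hθ => ?_⟩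
  obtain ⟨g, hg, h⟩ := hc (u θ) (hu hθ)
  exact ⟨_, Finset.mem_image_of_mem _ hg, fun x hx => h (v x) (hv hx)⟩

theorem of_bounded {F : Θ → X → ℝ} {ε : ℝ} (h : ∀ θ ∈ P, ∀ x ∈ D, |F θ x| ≤ ε) :
    HasUniformNet P D F ε 0 :=
  ⟨{fun _ => 0}, by simp, fun θ hθ => ⟨_, Finset.mem_singleton_self _, fun x hx => by
    simpa using h θ hθ x hx⟩⟩

theorem add {F G : Θ → X → ℝ} {ε ε' H H' : ℝ} (hF : HasUniformNet P D F ε H)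
    (hG : HasUniformNet P D G ε' H') :
    HasUniformNet P D (fun θ x => F θ x + G θ x) (ε + ε') (H + H') := by
  classical
  obtain ⟨S, hS, hSc⟩ := hF
  obtain ⟨T, hT, hTc⟩ := hG
  refine ⟨(S ×ˢ T).image (fun q x => q.1 x + q.2 x), ?_, fun θ hθ => ?_⟩
  · calc (((S ×ˢ T).image (fun q x => q.1 x + q.2 x)).card : ℝ) ≤ ((S ×ˢ T).card : ℝ) := by
          exact_mod_cast Finset.card_image_le
      _ = S.card * T.card := by rw [Finset.card_product]; push_cast; rfl
      _ ≤ Real.exp H * Real.exp H' := by gcongr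
      _ = Real.exp (H + H') := (Real.exp_add _ _).symm
  · obtain ⟨f, hf, h1⟩ := hSc θ hθ
    obtain ⟨g, hg, h2⟩ := hTc θ hθ
    refine ⟨_, Finset.mem_image_of_mem _ (Finset.mk_mem_product hf hg), fun x hx => ?_⟩
    have e : F θ x + G θ x - (f x + g x) = (F θ x - f x) + (G θ x - g x) := by ring
    rw [e]
    exact (abs_add_le _ _).trans (add_le_add (h1 x hx) (h2 x hx))

theorem sum {ι : Type*} (s : Finset ι) {F : ι → Θ → X → ℝ} {ε H : ι → ℝ}
    (h : ∀ i ∈ s, HasUniformNet P D (F i) (ε i) (H i)) :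
    HasUniformNet P D (fun θ x => ∑ i ∈ s, F i θ x) (∑ i ∈ s, ε i) (∑ i ∈ s, H i) := by
  classical
  induction s using Finset.induction_on with
  | empty => simpa using of_bounded (P := P) (D := D) (F := fun _ _ => 0) (ε := 0) (by simp)
  | insert a s ha ih =>
    simp only [Finset.sum_insert ha]
    exact (h a (Finset.mem_insert_self _ _)).add
      (ih fun i hi => h i (Finset.mem_insert_of_mem hi))

end HasUniformNet

theorem sum_Icc_pow_natAbs_le (N : ℕ) {q : ℝ} (hq0 : 0 ≤ q) (hq1 : q < 1) :
    ∑ k ∈ Finset.Icc (-(N : ℤ)) N, q ^ k.natAbs ≤ 1 + 2 * (q / (1 - q)) := by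
  have hs : ∑ k ∈ Finset.Icc (-(N : ℤ)) N, q ^ k.natAbs
      = 1 + 2 * ∑ i ∈ Finset.range N, q ^ (i + 1) := by
    induction N with
    | zero => simp
    | succ n ih =>
      have e : Finset.Icc (-((n + 1 : ℕ) : ℤ)) ((n + 1 : ℕ) : ℤ)
          = insert (-((n : ℤ) + 1)) (insert ((n : ℤ) + 1) (Finset.Icc (-(n : ℤ)) n)) := by
        ext k
        simp only [Finset.mem_Icc, Finset.mem_insert]
        push_cast
        omega
      rw [e, Finset.sum_insert, Finset.sum_insert, ih, Finset.sum_range_succ]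
      · have h1 : (-((n : ℤ) + 1)).natAbs = n + 1 := by omega
        have h2 : ((n : ℤ) + 1).natAbs = n + 1 := by omega
        rw [h1, h2]; ring
      · simp
      · simp only [Finset.mem_Icc, Finset.mem_insert]; omega
  rw [hs]
  have h1 : 0 < 1 - q := by linarith
  have : ∑ i ∈ Finset.range N, q ^ (i + 1) ≤ q / (1 - q) := by
    simp_rw [pow_succ']
    rw [← Finset.mul_sum, div_eq_mul_inv]
    gcongr
    rw [← tsum_geometric_of_lt_one hq0 hq1]
    exact (summable_geometric_of_lt_one hq0 hq1).sum_le_tsum _ fun _ _ => by positivity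
  linarith

/-- The lattice points of an `ℓ¹` ball, counted by an exponential moment. -/
theorem exists_lattice_ball {ι : Type*} [Fintype ι] (R : ℝ) {l : ℝ} (hl : 0 < l) :
    ∃ S : Finset (ι → ℤ), (∀ k : ι → ℤ, ∑ i, |(k i : ℝ)| ≤ R → k ∈ S) ∧
      (S.card : ℝ) ≤
        Real.exp (l * R + Fintype.card ι * Real.log (1 + 2 / (Real.exp l - 1))) := by
  classical
  set N := ⌊R⌋₊
  set B : Finset (ι → ℤ) := Fintype.piFinset fun _ => Finset.Icc (-(N : ℤ)) N
  have he : 1 < Real.exp l := Real.one_lt_exp_iff.2 hl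
  have hpos : 0 < 1 + 2 / (Real.exp l - 1) := by
    have : 0 < Real.exp l - 1 := by linarith
    positivity
  refine ⟨B.filter fun k => ∑ i, |(k i : ℝ)| ≤ R, fun k hk => ?_, ?_⟩
  · refine Finset.mem_filter.2 ⟨Fintype.mem_piFinset.2 fun i => ?_, hk⟩
    have h1 : |(k i : ℝ)| ≤ R :=
      (Finset.single_le_sum (f := fun i => |(k i : ℝ)|) (fun _ _ => abs_nonneg _)
        (Finset.mem_univ i)).trans hk
    have h2 : (k i).natAbs ≤ N := by
      apply Nat.le_floor
      rwa [Nat.cast_natAbs, Int.cast_abs]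
    rw [Finset.mem_Icc]
    omega
  · have hq : Real.exp (-l) < 1 := Real.exp_lt_one_iff.2 (by linarith)
    calc ((B.filter fun k => ∑ i, |(k i : ℝ)| ≤ R).card : ℝ)
        = ∑ k ∈ B.filter (fun k => ∑ i, |(k i : ℝ)| ≤ R), (1 : ℝ) := by simp
      _ ≤ ∑ k ∈ B.filter (fun k => ∑ i, |(k i : ℝ)| ≤ R),
            Real.exp (l * R) * ∏ i, Real.exp (-l) ^ (k i).natAbs := by
          refine Finset.sum_le_sum fun k hk => ?_
          have hk := (Finset.mem_filter.1 hk).2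
          simp_rw [← Real.exp_nat_mul]
          rw [← Real.exp_sum, ← Real.exp_add, Real.one_le_exp_iff]
          simp_rw [Nat.cast_natAbs, Int.cast_abs]
          rw [← Finset.sum_mul]
          nlinarith
      _ ≤ ∑ k ∈ B, Real.exp (l * R) * ∏ i, Real.exp (-l) ^ (k i).natAbs :=
          Finset.sum_le_sum_of_subset_of_nonneg (Finset.filter_subset _ _)
            fun _ _ _ => by positivity
      _ = Real.exp (l * R) *
            ∏ _i : ι, ∑ k ∈ Finset.Icc (-(N : ℤ)) N, Real.exp (-l) ^ k.natAbs := by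
          rw [← Finset.mul_sum, Finset.prod_univ_sum]
      _ ≤ Real.exp (l * R) * ∏ _i : ι, (1 + 2 / (Real.exp l - 1)) := by
          gcongr with i
          refine (sum_Icc_pow_natAbs_le N (Real.exp_pos _).le hq).trans_eq ?_
          rw [Real.exp_neg] at hq ⊢
          have : Real.exp l - 1 ≠ 0 := by linarith
          have : 1 - (Real.exp l)⁻¹ ≠ 0 := by linarith
          field_simp
      _ = _ := by
          rw [Finset.prod_const, Finset.card_univ, Real.exp_add, Real.exp_nat_mul,
            Real.exp_log hpos]

theorem exists_int_near (y : ℝ) : ∃ k : ℤ, |(k : ℝ)| ≤ |y| ∧ |y - k| ≤ 1 := by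
  rcases le_total 0 y with hy | hy
  · have h1 := Int.floor_le y
    have h2 := Int.lt_floor_add_one y
    have h3 : (0 : ℝ) ≤ ⌊y⌋ := by exact_mod_cast Int.floor_nonneg.2 hy
    refine ⟨⌊y⌋, ?_, ?_⟩
    · rwa [abs_of_nonneg hy, abs_of_nonneg h3]
    · rw [abs_le]; constructor <;> linarith
  · have h1 := Int.le_ceil y
    have h2 := Int.ceil_lt_add_one y
    have h3 : (⌈y⌉ : ℝ) ≤ 0 := by
      have := Int.ceil_mono hy
      rw [Int.ceil_zero] at this
      exact_mod_cast this
    refine ⟨⌈y⌉, ?_, ?_⟩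
    · rw [abs_of_nonpos hy, abs_of_nonpos h3]; linarith
    · rw [abs_le]; constructor <;> linarith

/-- Rounding the coefficients of a linear combination whose coefficient vector lies in an `ℓ¹`
ball. -/
theorem HasUniformNet.of_coeff {Θ X ι : Type*} [Fintype ι] {P : Set Θ} {D : Set X}
    {c : Θ → ι → ℝ} {φ : ι → X → ℝ} {Q B δ l : ℝ}
    (hc : ∀ θ ∈ P, ∑ i, |c θ i| ≤ Q) (hφ : ∀ x ∈ D, ∑ i, |φ i x| ≤ B)
    (hδ : 0 < δ) (hl : 0 < l) :
    HasUniformNet P D (fun θ x => ∑ i, c θ i * φ i x) (B * δ)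
      (l * (Q / δ) + Fintype.card ι * Real.log (1 + 2 / (Real.exp l - 1))) := by
  classical
  obtain ⟨S, hS, hcard⟩ := exists_lattice_ball (ι := ι) (Q / δ) hl
  refine ⟨S.image fun k x => ∑ i, (δ * k i) * φ i x,
    le_trans (by exact_mod_cast Finset.card_image_le) hcard, fun θ hθ => ?_⟩
  choose k hk1 hk2 using fun i => exists_int_near (c θ i / δ)
  refine ⟨_, Finset.mem_image_of_mem _ (hS k ?_), fun x hx => ?_⟩
  · rw [le_div_iff₀ hδ, Finset.sum_mul]
    refine le_trans (Finset.sum_le_sum fun i _ => ?_) (hc θ hθ)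
    have := hk1 i
    rwa [abs_div, abs_of_pos hδ, le_div_iff₀ hδ] at this
  · rw [← Finset.sum_sub_distrib]
    calc |∑ i, (c θ i * φ i x - δ * k i * φ i x)|
        ≤ ∑ i, |c θ i * φ i x - δ * k i * φ i x| := Finset.abs_sum_le_sum_abs _ _
      _ ≤ ∑ i, |φ i x| * δ := by
          refine Finset.sum_le_sum fun i _ => ?_
          rw [← sub_mul, abs_mul, mul_comm]
          gcongr
          have e : c θ i - δ * k i = (c θ i / δ - k i) * δ := by field_simp
          rw [e, abs_mul, abs_of_pos hδ]
          exact mul_le_of_le_one_left hδ.le (hk2 i)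
      _ = (∑ i, |φ i x|) * δ := (Finset.sum_mul _ _ _).symm
      _ ≤ B * δ := mul_le_mul_of_nonneg_right (hφ x hx) hδ.le

theorem log_one_add_two_div_exp_sub_one_le {l : ℝ} (hl : 0 < l) :
    Real.log (1 + 2 / (Real.exp l - 1)) ≤ Real.log (1 + 2 / l) := by
  have h : l ≤ Real.exp l - 1 := by linarith [Real.add_one_le_exp l]
  have : 0 < Real.exp l - 1 := by linarith
  gcongr

theorem log_one_add_two_div_exp_sub_one_nonneg {l : ℝ} (hl : 0 < l) :
    0 ≤ Real.log (1 + 2 / (Real.exp l - 1)) := by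
  have : 0 < Real.exp l - 1 := by linarith [Real.add_one_le_exp l]
  exact Real.log_nonneg (le_add_of_nonneg_right (by positivity))

theorem log_one_add_two_mul_two_pow_le (a : ℕ) : Real.log (1 + 2 * 2 ^ a) ≤ 2 + a := by
  have h1 : (1 : ℝ) ≤ 2 ^ a := one_le_pow₀ (by norm_num)
  have h2 : Real.log 2 ≤ 1 := by linarith [Real.log_two_lt_d9]
  calc Real.log (1 + 2 * 2 ^ a) ≤ Real.log (2 ^ 2 * 2 ^ a) := by
        apply Real.log_le_log <;> linarith
    _ = (2 + a) * Real.log 2 := by rw [← pow_add, Real.log_pow]; push_cast; rfl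
    _ ≤ 2 + a := mul_le_of_le_one_right (by positivity) h2

theorem sum_three_quarters_pow_le (n : ℕ) :
    ∑ d ∈ Finset.range (2 * n + 1), (3 / 4 : ℝ) ^ ((d - n) + (n - d)) ≤ 7 := by
  have h1 : ∀ n : ℕ, ∑ d ∈ Finset.range n, (3 / 4 : ℝ) ^ (n - d) ≤ 3 := by
    intro n
    induction n with
    | zero => simp
    | succ n ih =>
      have : ∑ d ∈ Finset.range (n + 1), (3 / 4 : ℝ) ^ (n + 1 - d)
          = 3 / 4 * (∑ d ∈ Finset.range n, (3 / 4 : ℝ) ^ (n - d) + 1) := by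
        rw [Finset.sum_range_succ, mul_add, Finset.mul_sum]
        congr 1
        · refine Finset.sum_congr rfl fun d hd => ?_
          have := Finset.mem_range.1 hd
          rw [← pow_succ']
          congr 1; omega
        · simp
      rw [this]; linarith
  have h2 : ∀ n : ℕ, ∑ d ∈ Finset.range n, (3 / 4 : ℝ) ^ d ≤ 4 := by
    intro n
    have := (summable_geometric_of_lt_one (r := (3 / 4 : ℝ)) (by norm_num)
      (by norm_num)).sum_le_tsum (Finset.range n) fun _ _ => by positivity
    rw [tsum_geometric_of_lt_one (by norm_num) (by norm_num)] at this
    linarith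
  have e : 2 * n + 1 = n + (n + 1) := by ring
  rw [e, Finset.sum_range_add]
  have h3 : ∑ d ∈ Finset.range n, (3 / 4 : ℝ) ^ ((d - n) + (n - d)) ≤ 3 := by
    refine (Finset.sum_congr rfl fun d hd => ?_).trans_le (h1 n)
    have := Finset.mem_range.1 hd
    congr 1; omega
  have h4 : ∑ d ∈ Finset.range (n + 1), (3 / 4 : ℝ) ^ ((n + d - n) + (n - (n + d))) ≤ 4 := by
    refine (Finset.sum_congr rfl fun d hd => ?_).trans_le (h2 (n + 1))
    congr 1; omega
  linarith

/-- The sum of the truncated powers whose knots are separated from `x` at dyadic level `d`: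
the knots between the left ends of the dyadic cells of lengths `2 ^ (1 - d)` and `2 ^ (-d)`
containing `x`. -/
noncomputable def dyadicJump (r m : ℕ) (t : ℕ → ℝ) (b : ℕ → ℝ) (d : ℕ) (x : ℝ) : ℝ :=
  ∑ i ∈ Finset.range m,
    if ((2 * (⌊2 ^ d * x⌋₊ / 2) : ℕ) : ℝ) < 2 ^ d * t (i + 1) ∧
      2 ^ d * t (i + 1) ≤ (⌊2 ^ d * x⌋₊ : ℝ) then b (r + 1 + i) * (x - t (i + 1)) ^ r else 0

theorem sum_dyadicJump (r m : ℕ) (t : ℕ → ℝ) (ht : ∀ i < m, 0 < t (i + 1)) (b : ℕ → ℝ)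
    {x : ℝ} (hx : x ∈ Set.Icc (0 : ℝ) 1) (L : ℕ) :
    ∑ d ∈ Finset.range (L + 1), dyadicJump r m t b d x =
      ∑ i ∈ Finset.range m, if 2 ^ L * t (i + 1) ≤ (⌊2 ^ L * x⌋₊ : ℝ)
        then b (r + 1 + i) * (x - t (i + 1)) ^ r else 0 := by
  induction L with
  | zero =>
    rw [zero_add, Finset.sum_range_one, dyadicJump]
    refine Finset.sum_congr rfl fun i hi => ?_
    have h0 := ht i (Finset.mem_range.1 hi)
    rcases hx.2.eq_or_lt with rfl | h1
    · simp [h0]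
    · have : ⌊x⌋₊ = 0 := Nat.floor_eq_zero.2 h1
      simp [this, h0]
  | succ L ih =>
    rw [Finset.sum_range_succ, ih, dyadicJump, ← Finset.sum_add_distrib]
    refine Finset.sum_congr rfl fun i _ => ?_
    have hf : ⌊2 ^ (L + 1) * x⌋₊ / 2 = ⌊2 ^ L * x⌋₊ := by
      have := Nat.floor_div_natCast (2 ^ (L + 1) * x) 2
      rw [← this]
      congr 1
      push_cast
      ring
    rw [hf]
    have hle : 2 * ⌊2 ^ L * x⌋₊ ≤ ⌊2 ^ (L + 1) * x⌋₊ := by omega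
    have hle' : (2 * ⌊2 ^ L * x⌋₊ : ℝ) ≤ ⌊2 ^ (L + 1) * x⌋₊ := by exact_mod_cast hle
    push_cast
    rw [pow_succ] at hle' ⊢
    split_ifs with h1 h2 h3 h3 h2 h3 h3
    all_goals first
      | (exfalso; linarith [h2.1])
      | (exfalso; linarith)
      | (exfalso; exact h2 ⟨by linarith, h3⟩)
      | ring

theorem abs_splineEval_sub_le (r m : ℕ) (t : ℕ → ℝ) (ht : ∀ i < m, 0 < t (i + 1)) (b : ℕ → ℝ)
    (hb : ∑ j ∈ Finset.range (r + 1 + m), |b j| ≤ 1) {x : ℝ} (hx : x ∈ Set.Icc (0 : ℝ) 1)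
    (L : ℕ) :
    |splineEval (r + 1) m t b x - ∑ j ∈ Finset.range (r + 1), b j * x ^ j -
      ∑ d ∈ Finset.range (L + 1), dyadicJump r m t b d x| ≤ (1 / 2 ^ L) ^ r := by
  rw [sum_dyadicJump r m t ht b hx, splineEval, add_sub_cancel_left, add_tsub_cancel_right,
    ← Finset.sum_sub_distrib]
  have h2 : (0 : ℝ) < 2 ^ L := by positivity
  calc _ ≤ ∑ i ∈ Finset.range m, |b (r + 1 + i)| * (1 / 2 ^ L) ^ r := by
        refine (Finset.abs_sum_le_sum_abs _ _).trans (Finset.sum_le_sum fun i _ => ?_)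
        split_ifs with h
        · have h1 : 2 ^ L * t (i + 1) ≤ 2 ^ L * x :=
            h.trans (Nat.floor_le (mul_nonneg h2.le hx.1))
          have h3 := le_of_mul_le_mul_left h1 h2
          rw [max_eq_left (by linarith), sub_self, abs_zero]
          positivity
        · rw [sub_zero, abs_mul, abs_of_nonneg (by positivity : 0 ≤ max (x - t (i + 1)) 0 ^ r)]
          gcongr
          refine max_le ?_ (by positivity)
          rw [le_div_iff₀ h2]
          have := Nat.lt_floor_add_one (2 ^ L * x)
          linarith
    _ = (∑ i ∈ Finset.range m, |b (r + 1 + i)|) * (1 / 2 ^ L) ^ r :=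
        (Finset.sum_mul _ _ _).symm
    _ ≤ 1 * (1 / 2 ^ L) ^ r := by
        gcongr
        rw [Finset.sum_range_add] at hb
        have : 0 ≤ ∑ j ∈ Finset.range (r + 1), |b j| := by positivity
        linarith
    _ = _ := one_mul _

theorem sum_ite_dyadic_le_one (d : ℕ) (s : ℝ) :
    ∑ j : Fin (2 ^ d + 1), (if ((2 * ((j : ℕ) / 2) : ℕ) : ℝ) < s ∧ s ≤ ((j : ℕ) : ℝ)
      then (1 : ℝ) else 0) ≤ 1 := by
  have key : ∀ j : ℕ, ((2 * (j / 2) : ℕ) : ℝ) < s ∧ s ≤ (j : ℝ) → j = ⌈s⌉₊ := by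
    intro j h
    have h1 : 2 * (j / 2) < ⌈s⌉₊ := Nat.lt_ceil.2 h.1
    have h2 : ⌈s⌉₊ ≤ j := Nat.ceil_le.2 h.2
    omega
  rw [Finset.sum_boole]
  exact_mod_cast Finset.card_le_one.2 fun a ha c hc => Fin.ext <| by
    rw [key a (Finset.mem_filter.1 ha).2, key c (Finset.mem_filter.1 hc).2]

theorem hasUniformNet_dyadicJump (r m d : ℕ) (t : ℕ → ℝ) {δ l : ℝ} (hδ : 0 < δ) (hl : 0 < l) :
    HasUniformNet {b : ℕ → ℝ | ∑ j ∈ Finset.range (r + 1 + m), |b j| ≤ 1} (Set.Icc (0 : ℝ) 1)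
      (fun b x => dyadicJump r m t b d x) (2 ^ r * δ)
      (l * (((r + 1) * (1 / 2 ^ d) ^ r) / δ) +
        (2 ^ d + 1) * (r + 1) * Real.log (1 + 2 / (Real.exp l - 1))) := by
  have h2 : (0 : ℝ) < 2 ^ d := by positivity
  let c : (ℕ → ℝ) → Fin (2 ^ d + 1) × Fin (r + 1) → ℝ := fun b q =>
    ∑ i ∈ Finset.range m, if ((2 * ((q.1 : ℕ) / 2) : ℕ) : ℝ) < 2 ^ d * t (i + 1) ∧
      2 ^ d * t (i + 1) ≤ ((q.1 : ℕ) : ℝ) then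
        b (r + 1 + i) * (((q.1 : ℕ) / 2 ^ d - t (i + 1)) ^ (r - q.2) * (1 / 2 ^ d) ^ (q.2 : ℕ))
      else 0
  let φ : Fin (2 ^ d + 1) × Fin (r + 1) → ℝ → ℝ := fun q x =>
    if (q.1 : ℕ) = ⌊2 ^ d * x⌋₊ then (r.choose q.2) * (2 ^ d * x - (q.1 : ℕ)) ^ (q.2 : ℕ) else 0
  have hfl : ∀ x ∈ Set.Icc (0 : ℝ) 1, ⌊2 ^ d * x⌋₊ < 2 ^ d + 1 := by
    intro x hx
    have : ⌊2 ^ d * x⌋₊ ≤ ⌊((2 ^ d : ℕ) : ℝ)⌋₊ := by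
      apply Nat.floor_mono
      push_cast
      exact mul_le_of_le_one_right h2.le hx.2
    rw [Nat.floor_natCast] at this
    omega
  have hc : ∀ b ∈ {b : ℕ → ℝ | ∑ j ∈ Finset.range (r + 1 + m), |b j| ≤ 1},
      ∑ q, |c b q| ≤ (r + 1) * (1 / 2 ^ d) ^ r := by
    intro b hb
    calc ∑ q, |c b q| ≤ ∑ q : Fin (2 ^ d + 1) × Fin (r + 1), ∑ i ∈ Finset.range m,
          (if ((2 * ((q.1 : ℕ) / 2) : ℕ) : ℝ) < 2 ^ d * t (i + 1) ∧
            2 ^ d * t (i + 1) ≤ ((q.1 : ℕ) : ℝ) then (1 : ℝ) else 0) *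
              (|b (r + 1 + i)| * (1 / 2 ^ d) ^ r) := by
          refine Finset.sum_le_sum fun q _ =>
            (Finset.abs_sum_le_sum_abs _ _).trans (Finset.sum_le_sum fun i _ => ?_)
          split_ifs with h
          · rw [one_mul, abs_mul]
            gcongr
            have e : (1 / 2 ^ d : ℝ) ^ r = (1 / 2 ^ d) ^ (r - q.2) * (1 / 2 ^ d) ^ (q.2 : ℕ) := by
              rw [← pow_add]
              congr 1
              have := q.2.2
              omega
            have h0 : 0 ≤ ((q.1 : ℕ) : ℝ) / 2 ^ d - t (i + 1) := by
              rw [sub_nonneg, le_div_iff₀ h2, mul_comm]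
              exact h.2
            rw [e, abs_of_nonneg (by positivity)]
            gcongr
            rw [sub_le_iff_le_add, div_le_iff₀ h2, add_mul, one_div_mul_cancel h2.ne']
            have : (q.1 : ℕ) ≤ 2 * ((q.1 : ℕ) / 2) + 1 := by omega
            have : ((q.1 : ℕ) : ℝ) ≤ ((2 * ((q.1 : ℕ) / 2) : ℕ) : ℝ) + 1 := by exact_mod_cast this
            linarith [h.1]
          · simp
      _ = ∑ _l : Fin (r + 1), ∑ i ∈ Finset.range m, (∑ j : Fin (2 ^ d + 1),
          (if ((2 * ((j : ℕ) / 2) : ℕ) : ℝ) < 2 ^ d * t (i + 1) ∧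
            2 ^ d * t (i + 1) ≤ ((j : ℕ) : ℝ) then (1 : ℝ) else 0)) *
              (|b (r + 1 + i)| * (1 / 2 ^ d) ^ r) := by
          rw [Fintype.sum_prod_type_right]
          refine Finset.sum_congr rfl fun l _ => ?_
          rw [Finset.sum_comm]
          refine Finset.sum_congr rfl fun i _ => ?_
          rw [Finset.sum_mul]
      _ ≤ ∑ _l : Fin (r + 1), ∑ i ∈ Finset.range m, 1 * (|b (r + 1 + i)| * (1 / 2 ^ d) ^ r) := by
          gcongr
          exact sum_ite_dyadic_le_one d _
      _ = (r + 1) * ((∑ i ∈ Finset.range m, |b (r + 1 + i)|) * (1 / 2 ^ d) ^ r) := by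
          simp only [one_mul, ← Finset.sum_mul, Finset.sum_const, Finset.card_univ,
            Fintype.card_fin, nsmul_eq_mul]
          push_cast
          ring
      _ ≤ (r + 1) * (1 * (1 / 2 ^ d) ^ r) := by
          gcongr
          have hb' : ∑ j ∈ Finset.range (r + 1 + m), |b j| ≤ 1 := hb
          rw [Finset.sum_range_add] at hb'
          have : 0 ≤ ∑ j ∈ Finset.range (r + 1), |b j| := by positivity
          linarith
      _ = _ := by rw [one_mul]
  have hsum : ∀ (x : ℝ) (hx : x ∈ Set.Icc (0 : ℝ) 1) (f : Fin (2 ^ d + 1) × Fin (r + 1) → ℝ),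
      (∀ q, (q.1 : ℕ) ≠ ⌊2 ^ d * x⌋₊ → f q = 0) →
        ∑ q, f q = ∑ k : Fin (r + 1), f (⟨⌊2 ^ d * x⌋₊, hfl x hx⟩, k) := by
    intro x hx f hf
    rw [Fintype.sum_prod_type]
    refine Fintype.sum_eq_single _ fun j hj => Finset.sum_eq_zero fun k _ => hf _ fun h => ?_
    exact hj (Fin.ext h)
  have hφ : ∀ x ∈ Set.Icc (0 : ℝ) 1, ∑ q, |φ q x| ≤ 2 ^ r := by
    intro x hx
    have h0 : 0 ≤ 2 ^ d * x - ⌊2 ^ d * x⌋₊ :=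
      sub_nonneg.2 (Nat.floor_le (mul_nonneg h2.le hx.1))
    have h1 : 2 ^ d * x - ⌊2 ^ d * x⌋₊ ≤ 1 := by linarith [Nat.lt_floor_add_one (2 ^ d * x)]
    rw [hsum x hx _ fun q hq => by simp only [φ, if_neg hq, abs_zero]]
    have e : (2 : ℝ) ^ r = ∑ k : Fin (r + 1), (r.choose k : ℝ) := by
      rw [Fin.sum_univ_eq_sum_range (fun k => (r.choose k : ℝ))]
      exact_mod_cast (Nat.sum_range_choose r).symm
    rw [e]
    refine Finset.sum_le_sum fun k _ => ?_
    simp only [φ, if_true]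
    rw [abs_of_nonneg (by positivity)]
    exact mul_le_of_le_one_right (by positivity) (pow_le_one₀ h0 h1)
  have hnet := (HasUniformNet.of_coeff hc hφ hδ hl).mono le_rfl
    (le_of_eq (by simp) : _ ≤ l * (((r + 1) * (1 / 2 ^ d) ^ r) / δ) +
      (2 ^ d + 1) * (r + 1) * Real.log (1 + 2 / (Real.exp l - 1)))
  refine hnet.congr fun b _ x hx => ?_
  rw [hsum x hx _ fun q hq => by simp only [φ, if_neg hq, mul_zero]]
  simp only [φ, c, if_true, Finset.sum_mul]
  rw [Finset.sum_comm, dyadicJump]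
  refine Finset.sum_congr rfl fun i _ => ?_
  split_ifs with h
  · have e : x - t (i + 1) = 1 / 2 ^ d * (2 ^ d * x - ⌊2 ^ d * x⌋₊) +
        (⌊2 ^ d * x⌋₊ / 2 ^ d - t (i + 1)) := by
      field_simp
      ring
    rw [e, add_pow, Finset.mul_sum, ← Fin.sum_univ_eq_sum_range
      (fun k => b (r + 1 + i) * ((1 / 2 ^ d * (2 ^ d * x - ⌊2 ^ d * x⌋₊)) ^ k *
        (⌊2 ^ d * x⌋₊ / 2 ^ d - t (i + 1)) ^ (r - k) * (r.choose k : ℝ)))]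
    refine Finset.sum_congr rfl fun k _ => ?_
    rw [mul_pow]
    ring
  · simp

theorem hasUniformNet_dyadicJump_of_scale (r m d n : ℕ) (t : ℕ → ℝ) (hr : 1 ≤ r) :
    HasUniformNet {b : ℕ → ℝ | ∑ j ∈ Finset.range (r + 1 + m), |b j| ≤ 1} (Set.Icc (0 : ℝ) 1)
      (fun b x => dyadicJump r m t b d x)
      (2 ^ r * (1 / 2 ^ (n * (r + 1)) * (3 / 4) ^ ((d - n) + (n - d))))
      (12 * (r + 2) ^ 2 * 2 ^ n * (3 / 4) ^ ((d - n) + (n - d))) := by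
  rcases le_total n d with h | h
  · obtain ⟨s, rfl⟩ := Nat.exists_eq_add_of_le h
    have e1 : (n + s - n) + (n - (n + s)) = s := by omega
    rw [e1]
    refine (hasUniformNet_dyadicJump r m (n + s) t (by positivity)
      (by positivity : (0 : ℝ) < 1 + s)).mono le_rfl ?_
    have hQ : ((r + 1) * (1 / 2 ^ (n + s)) ^ r) / (1 / 2 ^ (n * (r + 1)) * (3 / 4 : ℝ) ^ s)
        ≤ (r + 1) * 2 ^ n * (2 / 3) ^ s := by
      rw [div_le_iff₀ (by positivity)]
      have a1 : ((1 : ℝ) / 2 ^ (n + s)) ^ r = (1 / 2 ^ n) ^ r * ((1 / 2) ^ s) ^ r := by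
        rw [← mul_pow, one_div_pow 2 s, pow_add, one_div_mul_one_div]
      have a2 : (r + 1) * 2 ^ n * (2 / 3) ^ s * (1 / 2 ^ (n * (r + 1)) * (3 / 4 : ℝ) ^ s)
          = (r + 1) * ((1 / 2 ^ n) ^ r * (1 / 2) ^ s) := by
        have b1 : (1 / 2 : ℝ) ^ s = (2 / 3) ^ s * (3 / 4) ^ s := by rw [← mul_pow]; norm_num
        have b2 : (2 : ℝ) ^ n * (1 / 2 ^ (n * (r + 1))) = (1 / 2 ^ n) ^ r := by
          rw [pow_mul, pow_succ, one_div_pow]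
          field_simp
        rw [b1, ← b2]
        ring
      rw [a1, a2]
      gcongr
      exact pow_le_of_le_one (by positivity) (pow_le_one₀ (by norm_num) (by norm_num)) (by omega)
    have hexp : ((8 : ℝ) / 3) ^ s ≤ Real.exp (1 + s) - 1 := by
      have b1 := Real.exp_one_gt_d9
      have b2 : ((8 : ℝ) / 3) ^ s ≤ Real.exp s := by
        rw [← Real.exp_one_pow]
        gcongr
        linarith
      have b3 : (1 : ℝ) ≤ Real.exp s := Real.one_le_exp (by positivity)
      rw [Real.exp_add]
      nlinarith
    have hlog : Real.log (1 + 2 / (Real.exp (1 + s) - 1)) ≤ 2 / (8 / 3) ^ s := by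
      have b1 : (0 : ℝ) < (8 / 3) ^ s := by positivity
      have b2 : 2 / (Real.exp (1 + s) - 1) ≤ 2 / (8 / 3) ^ s := by gcongr
      have b3 : 0 < 2 / (Real.exp (1 + s) - 1) := div_pos two_pos (by linarith)
      linarith [Real.log_le_sub_one_of_pos (by linarith : 0 < 1 + 2 / (Real.exp (1 + s) - 1))]
    have hlog0 := log_one_add_two_div_exp_sub_one_nonneg (by positivity : (0 : ℝ) < 1 + s)
    have hs : (1 + s : ℝ) ≤ 8 * (9 / 8) ^ s := by
      have := one_add_mul_le_pow (a := (1 / 8 : ℝ)) (by norm_num) s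
      norm_num at this
      linarith
    have c1 : ((9 : ℝ) / 8) ^ s * (2 / 3) ^ s = (3 / 4) ^ s := by rw [← mul_pow]; norm_num
    have c2 : (2 : ℝ) ^ s * (1 / (8 / 3) ^ s) = (3 / 4) ^ s := by
      rw [← one_div_pow, ← mul_pow]; norm_num
    have c3 : (1 : ℝ) ≤ 2 ^ (n + s) := one_le_pow₀ (by norm_num)
    calc _ ≤ 8 * (9 / 8 : ℝ) ^ s * (((r : ℝ) + 1) * 2 ^ n * (2 / 3) ^ s) +
          (2 ^ (n + s) + 2 ^ (n + s)) * (r + 1) * (2 / (8 / 3) ^ s) := by gcongr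
      _ = 8 * ((r : ℝ) + 1) * 2 ^ n * ((9 / 8) ^ s * (2 / 3) ^ s) +
          4 * (r + 1) * 2 ^ n * (2 ^ s * (1 / (8 / 3) ^ s)) := by rw [pow_add]; ring
      _ = 12 * ((r : ℝ) + 1) * 2 ^ n * (3 / 4) ^ s := by rw [c1, c2]; ring
      _ ≤ 12 * ((r : ℝ) + 2) ^ 2 * 2 ^ n * (3 / 4) ^ s := by
          gcongr
          nlinarith [(Nat.cast_nonneg r : (0 : ℝ) ≤ r)]
  · obtain ⟨u, rfl⟩ := Nat.exists_eq_add_of_le h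
    have e1 : (d - (d + u)) + (d + u - d) = u := by omega
    rw [e1]
    have hl : (0 : ℝ) < 1 / 2 ^ ((r + 2) * u) := by positivity
    refine (hasUniformNet_dyadicJump r m d t (by positivity) hl).mono le_rfl ?_
    have hQ : ((r + 1) * (1 / 2 ^ d) ^ r) / (1 / 2 ^ ((d + u) * (r + 1)) * (3 / 4 : ℝ) ^ u)
        ≤ (r + 1) * 2 ^ d * 2 ^ ((r + 2) * u) := by
      rw [div_le_iff₀ (by positivity)]
      have a2 : (r + 1) * 2 ^ d * 2 ^ ((r + 2) * u) *
          (1 / 2 ^ ((d + u) * (r + 1)) * (3 / 4 : ℝ) ^ u)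
          = (r + 1) * (1 / 2 ^ d) ^ r * (2 ^ u * (3 / 4) ^ u) := by
        have b2 : (2 : ℝ) ^ d * 2 ^ ((r + 2) * u) * (1 / 2 ^ ((d + u) * (r + 1)))
            = (1 / 2 ^ d) ^ r * 2 ^ u := by
          rw [one_div_pow, ← pow_mul, mul_one_div, div_eq_iff (by positivity), mul_assoc,
            one_div_mul_eq_div, eq_div_iff (by positivity)]
          simp only [← pow_add]
          congr 1
          ring
        calc _ = (r + 1) * (2 ^ d * 2 ^ ((r + 2) * u) * (1 / 2 ^ ((d + u) * (r + 1)))) *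
              (3 / 4 : ℝ) ^ u := by ring
          _ = _ := by rw [b2]; ring
      rw [a2]
      refine le_mul_of_one_le_right (by positivity) ?_
      rw [← mul_pow]
      exact one_le_pow₀ (by norm_num)
    have hlog := (log_one_add_two_div_exp_sub_one_le hl).trans_eq (by rw [div_div_eq_mul_div, div_one])
      |>.trans (log_one_add_two_mul_two_pow_le ((r + 2) * u))
    have hlog0 := log_one_add_two_div_exp_sub_one_nonneg hl
    have hu : (1 + u * (1 / 2) : ℝ) ≤ (3 / 2) ^ u := by
      have := one_add_mul_le_pow (a := (1 / 2 : ℝ)) (by norm_num) u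
      norm_num at this ⊢
      linarith
    have c1 : (2 : ℝ) ^ u * (3 / 4) ^ u = (3 / 2) ^ u := by rw [← mul_pow]; norm_num
    have c3 : (1 : ℝ) ≤ 2 ^ d := one_le_pow₀ (by norm_num)
    have hr0 : (0 : ℝ) ≤ r := Nat.cast_nonneg r
    have hu0 : (0 : ℝ) ≤ u := Nat.cast_nonneg u
    push_cast at hlog
    calc _ ≤ 1 / 2 ^ ((r + 2) * u) * (((r : ℝ) + 1) * 2 ^ d * 2 ^ ((r + 2) * u)) +
          (2 ^ d + 2 ^ d) * (r + 1) * (2 + (r + 2) * u) := by gcongr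
      _ = 2 ^ d * (((r : ℝ) + 1) * (5 + 2 * (r + 2) * u)) := by field_simp; ring
      _ ≤ 2 ^ d * (12 * ((r : ℝ) + 2) ^ 2 * (1 + u * (1 / 2))) := by
          gcongr 2 ^ d * ?_
          nlinarith [mul_nonneg hr0 hu0, mul_nonneg (mul_nonneg hr0 hr0) hu0, mul_nonneg hr0 hr0]
      _ ≤ 2 ^ d * (12 * ((r : ℝ) + 2) ^ 2 * (3 / 2) ^ u) := by gcongr
      _ = _ := by rw [← c1, pow_add]; ring

theorem hasUniformNet_polynomial (r m n : ℕ) :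
    HasUniformNet {b : ℕ → ℝ | ∑ j ∈ Finset.range (r + 1 + m), |b j| ≤ 1} (Set.Icc (0 : ℝ) 1)
      (fun b x => ∑ j ∈ Finset.range (r + 1), b j * x ^ j)
      ((r + 1) * (1 / 2 ^ (n * (r + 1)))) ((r + 2) ^ 2 * 2 ^ n) := by
  have hδ : (0 : ℝ) < 1 / 2 ^ (n * (r + 1)) := by positivity
  have h := HasUniformNet.of_coeff (ι := Fin (r + 1))
    (P := {b : ℕ → ℝ | ∑ j ∈ Finset.range (r + 1 + m), |b j| ≤ 1}) (D := Set.Icc (0 : ℝ) 1)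
    (c := fun b j => b j) (φ := fun j x => x ^ (j : ℕ)) (Q := 1) (B := r + 1) ?_ ?_ hδ hδ
  · refine (h.congr fun b _ x _ => ?_).mono le_rfl ?_
    · exact (Fin.sum_univ_eq_sum_range (fun j => b j * x ^ j) (r + 1)).symm
    · have hlog := (log_one_add_two_div_exp_sub_one_le hδ).trans_eq
        (by rw [div_div_eq_mul_div, div_one])
        |>.trans (log_one_add_two_mul_two_pow_le (n * (r + 1)))
      rw [mul_one_div_cancel hδ.ne', Fintype.card_fin]
      push_cast at hlog ⊢
      have h1 : (n : ℝ) ≤ 2 ^ n := by exact_mod_cast Nat.lt_two_pow_self.le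
      have h2 : (1 : ℝ) ≤ 2 ^ n := one_le_pow₀ (by norm_num)
      calc _ ≤ 1 + (r + 1 : ℝ) * (2 + n * (r + 1)) := by gcongr
        _ = (1 + 2 * (r + 1)) * 1 + (r + 1) ^ 2 * n := by ring
        _ ≤ (1 + 2 * (r + 1)) * 2 ^ n + (r + 1) ^ 2 * 2 ^ n := by gcongr
        _ = _ := by ring
  · intro b hb
    have hb' : ∑ j ∈ Finset.range (r + 1 + m), |b j| ≤ 1 := hb
    rw [Finset.sum_range_add] at hb'
    have : 0 ≤ ∑ j ∈ Finset.range m, |b (r + 1 + j)| := by positivity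
    rw [Fin.sum_univ_eq_sum_range (fun j => |b j|)]
    linarith
  · intro x hx
    calc ∑ j : Fin (r + 1), |x ^ (j : ℕ)| ≤ ∑ _j : Fin (r + 1), (1 : ℝ) := by
          refine Finset.sum_le_sum fun j _ => ?_
          rw [abs_of_nonneg (pow_nonneg hx.1 _)]
          exact pow_le_one₀ hx.1 hx.2
      _ = r + 1 := by simp

theorem hasUniformNet_splineEval (r m n : ℕ) (hr : 1 ≤ r) (t : ℕ → ℝ)
    (ht : ∀ i < m, 0 < t (i + 1)) :
    HasUniformNet {b : ℕ → ℝ | ∑ j ∈ Finset.range (r + 1 + m), |b j| ≤ 1} (Set.Icc (0 : ℝ) 1)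
      (fun b x => splineEval (r + 1) m t b x)
      ((r + 2 + 7 * 2 ^ r) * (1 / 2 ^ (n * (r + 1)))) (85 * (r + 2) ^ 2 * 2 ^ n) := by
  have h1 := hasUniformNet_polynomial r m n
  have h2 := HasUniformNet.sum (Finset.range (2 * n + 1)) fun d _ =>
    hasUniformNet_dyadicJump_of_scale r m d n t hr
  have h3 := HasUniformNet.of_bounded fun b
    (hb : b ∈ {b : ℕ → ℝ | ∑ j ∈ Finset.range (r + 1 + m), |b j| ≤ 1}) x hx =>
      abs_splineEval_sub_le r m t ht b hb hx (2 * n)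
  refine (((h1.add h2).add h3).congr fun b _ x _ => by ring).mono ?_ ?_
  · have h4 : ((1 : ℝ) / 2 ^ (2 * n)) ^ r ≤ 1 / 2 ^ (n * (r + 1)) := by
      rw [one_div_pow, ← pow_mul]
      refine one_div_le_one_div_of_le (by positivity) (pow_le_pow_right₀ one_le_two ?_)
      nlinarith
    rw [← Finset.mul_sum, ← Finset.mul_sum]
    calc _ ≤ ((r : ℝ) + 1) * (1 / 2 ^ (n * (r + 1))) + 2 ^ r * (1 / 2 ^ (n * (r + 1)) * 7) +
          1 / 2 ^ (n * (r + 1)) := by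
          gcongr
          exact sum_three_quarters_pow_le n
      _ = _ := by ring
  · rw [← Finset.mul_sum, add_zero]
    calc _ ≤ ((r : ℝ) + 2) ^ 2 * 2 ^ n + 12 * (r + 2) ^ 2 * 2 ^ n * 7 := by
          gcongr
          exact sum_three_quarters_pow_le n
      _ = _ := by ring

theorem abs_splineEval_le (p m : ℕ) (t : ℕ → ℝ) (ht : ∀ i < m, 0 < t (i + 1)) (b : ℕ → ℝ)
    {x : ℝ} (hx : x ∈ Set.Icc (0 : ℝ) 1) :
    |splineEval p m t b x| ≤ ∑ j ∈ Finset.range (p + m), |b j| := by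
  rw [splineEval, Finset.sum_range_add]
  refine (abs_add_le _ _).trans (add_le_add ?_ ?_) <;>
    refine (Finset.abs_sum_le_sum_abs _ _).trans (Finset.sum_le_sum fun i hi => ?_) <;>
    rw [abs_mul] <;> refine mul_le_of_le_one_right (abs_nonneg _) ?_
  · rw [abs_of_nonneg (pow_nonneg hx.1 _)]
    exact pow_le_one₀ hx.1 hx.2
  · rw [abs_of_nonneg (by positivity)]
    exact pow_le_one₀ (le_max_right _ _)
      (max_le (by linarith [hx.2, ht i (Finset.mem_range.1 hi)]) zero_le_one)

theorem sqrt_mean_sq_le {n : ℕ} {u : Fin n → ℝ} {δ : ℝ} (hδ : 0 ≤ δ) (hu : ∀ i, |u i| ≤ δ) :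
    Real.sqrt ((1 / (n : ℝ)) * ∑ i, u i ^ 2) ≤ δ := by
  rw [Real.sqrt_le_left hδ]
  rcases Nat.eq_zero_or_pos n with rfl | hn
  · simp [sq_nonneg]
  · calc (1 / (n : ℝ)) * ∑ i, u i ^ 2 ≤ (1 / (n : ℝ)) * ∑ _i : Fin n, δ ^ 2 := by
          gcongr (1 / (n : ℝ)) * ?_
          exact Finset.sum_le_sum fun i _ => sq_le_sq.2 ((hu i).trans (le_abs_self δ))
      _ = δ ^ 2 := by
          have : (n : ℝ) ≠ 0 := by positivity
          simp only [Finset.sum_const, Finset.card_univ, Fintype.card_fin, nsmul_eq_mul]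
          field_simp

theorem HasUniformNet.exists_fin {Θ X : Type*} {P : Set Θ} {D : Set X} {F : Θ → X → ℝ}
    {ε H : ℝ} (h : HasUniformNet P D F ε H) (hH : 0 ≤ H) :
    ∃ (N : ℕ) (g : Fin N → X → ℝ), (∀ θ ∈ P, ∃ j, ∀ x ∈ D, |F θ x - g j x| ≤ ε) ∧
      Real.log N ≤ H := by
  obtain ⟨T, hT, hc⟩ := h
  refine ⟨T.card, fun j => T.equivFin.symm j, fun θ hθ => ?_, ?_⟩
  · obtain ⟨g, hg, h⟩ := hc θ hθ
    exact ⟨T.equivFin ⟨g, hg⟩, by simpa using h⟩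
  · rcases T.card.eq_zero_or_pos with h0 | h0
    · simpa [h0] using hH
    · exact (Real.log_le_iff_le_exp (by exact_mod_cast h0)).2 hT

/-- The additive version of `hasUniformNet_splineEval`, at an arbitrary scale `δ`. -/
theorem hasUniformNet_additive_spline (r K : ℕ) (hr : 1 ≤ r) (hK : 1 ≤ K) (m : Fin K → ℕ)
    (t : Fin K → ℕ → ℝ) (ht : ∀ k, ∀ i < m k, 0 < t k (i + 1)) {δ : ℝ} (hδ : 0 < δ) :
    HasUniformNet {b : Fin K → ℕ → ℝ | ∑ k, ∑ j ∈ Finset.range (r + 1 + m k), |b k j| ≤ 1}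
      {x : Fin K → ℝ | ∀ k, x k ∈ Set.Icc (0 : ℝ) 1}
      (fun b x => ∑ k, splineEval (r + 1) (m k) (t k) (b k) (x k)) δ
      (170 * K * (r + 2) ^ 2 * (K * (r + 2 + 7 * 2 ^ r)) ^ (1 / ((r + 1 : ℕ) : ℝ)) *
        δ ^ (-(1 / ((r + 1 : ℕ) : ℝ)))) := by
  set a : ℝ := K * (r + 2 + 7 * 2 ^ r)
  set s : ℝ := 1 / ((r + 1 : ℕ) : ℝ)
  have hs : 0 < s := by positivity
  have hK' : (1 : ℝ) ≤ K := by exact_mod_cast hK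
  have ha : 1 ≤ a := by
    have : (1 : ℝ) ≤ r + 2 + 7 * 2 ^ r := by
      have : (0 : ℝ) ≤ 7 * 2 ^ r := by positivity
      linarith [(Nat.cast_nonneg r : (0 : ℝ) ≤ r)]
    exact one_le_mul_of_one_le_of_one_le hK' this
  have ha0 : 0 < a := by linarith
  rcases le_total a δ with h | h
  · refine (HasUniformNet.of_bounded (ε := 1) fun b hb x hx => ?_).mono (ha.trans h)
      (by positivity)
    refine ((Finset.abs_sum_le_sum_abs _ _).trans (Finset.sum_le_sum fun k _ => ?_)).trans hb
    exact abs_splineEval_le _ _ _ (ht k) _ (hx k)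
  · have hy : 1 ≤ (a / δ) ^ s := Real.one_le_rpow ((one_le_div hδ).2 h) hs.le
    obtain ⟨n, hn1, hn2⟩ := exists_nat_pow_near hy one_lt_two
    have hnet := HasUniformNet.sum (Finset.univ : Finset (Fin K)) fun k _ =>
      (hasUniformNet_splineEval r (m k) (n + 1) hr (t k) (ht k)).comp
        (P' := {b : Fin K → ℕ → ℝ | ∑ k, ∑ j ∈ Finset.range (r + 1 + m k), |b k j| ≤ 1})
        (D' := {x : Fin K → ℝ | ∀ k, x k ∈ Set.Icc (0 : ℝ) 1})
        (u := fun b => b k) (v := fun x => x k)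
        (fun b hb => (Finset.single_le_sum
          (f := fun k => ∑ j ∈ Finset.range (r + 1 + m k), |b k j|)
          (fun k _ => by positivity) (Finset.mem_univ k)).trans hb)
        (fun x hx => hx k)
    simp only [Finset.sum_const, Finset.card_univ, Fintype.card_fin, nsmul_eq_mul] at hnet
    refine hnet.mono ?_ ?_
    · rw [← mul_assoc, mul_one_div, div_le_iff₀ (by positivity), pow_mul, mul_comm δ,
        ← div_le_iff₀ hδ]
      calc a / δ = ((a / δ) ^ s) ^ (r + 1) := by
            rw [← Real.rpow_natCast, ← Real.rpow_mul (by positivity)]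
            simp only [s]
            rw [one_div_mul_cancel (by positivity), Real.rpow_one]
        _ ≤ _ := by gcongr
    · calc (K : ℝ) * (85 * (r + 2) ^ 2 * 2 ^ (n + 1))
          = 170 * K * (r + 2) ^ 2 * 2 ^ n := by ring
        _ ≤ 170 * K * (r + 2) ^ 2 * (a / δ) ^ s := by gcongr
        _ = _ := by
            rw [Real.div_rpow ha0.le hδ.le, Real.rpow_neg hδ.le]
            ring

/-- Entropy bound for the unit penalty ball of additive splines: for fixed `p ≥ 2` and
`K ≥ 1` there is a constant `M > 0`, independent of `δ`, of `n`, of the design points in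
`[0,1]^K` and of the knot sequences, such that the set
`F_n(1) = {Σ_k g_k : g_k ∈ S(p, t_k), Σ_k P(g_k) ≤ 1}` (with `P` the ℓ¹ norm of the
truncated power basis coefficients) admits, for every `δ > 0`, a `δ`-cover in the
empirical seminorm `‖·‖_n` whose log-cardinality is at most `M·δ^{−1/p}`. -/
theorem entropy_bound_additive_splines (p K : ℕ) (hp : 2 ≤ p) (hK : 1 ≤ K) :
    ∃ M : ℝ, 0 < M ∧
      ∀ (n : ℕ) (x : Fin n → Fin K → ℝ),
        (∀ i k, x i k ∈ Set.Icc (0 : ℝ) 1) →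
        ∀ (pk : Fin K → ℕ) (t : Fin K → ℕ → ℝ),
          (∀ k i, 1 ≤ i → i ≤ pk k → t k i ∈ Set.Ioo (0 : ℝ) 1) →
          (∀ k i, 1 ≤ i → i < pk k → t k i < t k (i + 1)) →
          ∀ δ : ℝ, 0 < δ →
            ∃ (N : ℕ) (cen : Fin N → (Fin K → ℝ) → ℝ),
              (∀ b : Fin K → ℕ → ℝ,
                (∑ k, ∑ j ∈ Finset.range (p + pk k), |b k j|) ≤ 1 →
                ∃ jj : Fin N, Real.sqrt ((1 / (n : ℝ)) *
                  ∑ i, ((∑ k, splineEval p (pk k) (t k) (b k) (x i k)) - cen jj (x i)) ^ 2)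
                    ≤ δ) ∧
              Real.log N ≤ M * δ ^ (-(1 / (p : ℝ))) := by
  obtain ⟨r, rfl⟩ : ∃ r, p = r + 1 := ⟨p - 1, by omega⟩
  refine ⟨170 * K * (r + 2) ^ 2 * (K * (r + 2 + 7 * 2 ^ r)) ^ (1 / ((r + 1 : ℕ) : ℝ)), ?_, ?_⟩
  · have : (0 : ℝ) < K := by exact_mod_cast hK
    positivity
  · intro n x hx m t ht _ δ hδ
    obtain ⟨N, g, hg, hN⟩ := (hasUniformNet_additive_spline r K (by omega) hK m t
      (fun k i hi => (ht k (i + 1) (by omega) (by omega)).1) hδ).exists_fin (by positivity)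
    refine ⟨N, g, fun b hb => ?_, hN⟩
    obtain ⟨j, hj⟩ := hg b hb
    exact ⟨j, sqrt_mean_sq_le hδ.le fun i => hj (x i) (hx i)⟩
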